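/- arXiv:1411.6832 — 2 statements merged into one kernel-verified Lean document; each statement's English description precedes it below -/
import Mathlib

section
/- Let G be a connected simple graph and let u, v be two distinct vertices of G with uv not an edge of G. Then the Harary spectral radius strictly increases when the edge uv is added: ρ(G) < ρ(G + uv). -/
open scoped Classical

noncomputable def hararyMatrix {V : Type*} [Finite V] (G : SimpleGraph V) : Matrix V V ℝ :=
  Matrix.of fun i j => if i = j then 0 else ((G.dist i j : ℝ))⁻¹

noncomputable def hararyRho {V : Type*} [Finite V] (G : SimpleGraph V) : ℝ :=
  letI := Fintype.ofFinite V
  sSup {μ : ℝ | Module.End.HasEigenvalue (Matrix.toLin' (hararyMatrix G)) μ}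

open Matrix Module.End

section Spectrum

variable {n : Type*} [Fintype n] [DecidableEq n] {A : Matrix n n ℝ}

theorem Matrix.finite_setOf_hasEigenvalue (A : Matrix n n ℝ) :
    {μ : ℝ | HasEigenvalue (toLin' A) μ}.Finite :=
  Module.End.finite_hasEigenvalue _

theorem Matrix.IsHermitian.hasEigenvalue_toLin' (hA : A.IsHermitian) (i : n) :
    HasEigenvalue (toLin' A) (hA.eigenvalues i) := by
  rw [hasEigenvalue_iff_mem_spectrum, Matrix.spectrum_toLin']
  exact hA.eigenvalues_mem_spectrum_real i

theorem Matrix.IsHermitian.hasEigenvalue_sSup [Nonempty n] (hA : A.IsHermitian) :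
    HasEigenvalue (toLin' A) (sSup {μ : ℝ | HasEigenvalue (toLin' A) μ}) :=
  Set.Nonempty.csSup_mem ⟨_, hA.hasEigenvalue_toLin' (Classical.arbitrary n)⟩
    A.finite_setOf_hasEigenvalue

theorem Matrix.IsHermitian.posSemidef_smul_one_sub (hA : A.IsHermitian) {c : ℝ}
    (hc : ∀ μ, HasEigenvalue (toLin' A) μ → μ ≤ c) : (c • (1 : Matrix n n ℝ) - A).PosSemidef := by
  have hB : (c • (1 : Matrix n n ℝ) - A).IsHermitian := by
    refine IsHermitian.sub ?_ hA
    simp [IsHermitian]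
  rw [hB.posSemidef_iff_eigenvalues_nonneg]
  intro i
  obtain ⟨w, hw⟩ := (hB.hasEigenvalue_toLin' i).exists_hasEigenvector
  have h : A *ᵥ w = (c - hB.eigenvalues i) • w := by
    have := hw.apply_eq_smul
    rw [toLin'_apply, sub_mulVec, smul_mulVec, one_mulVec] at this
    rw [sub_smul, ← this, sub_sub_cancel]
  have := hc _ (hasEigenvalue_of_hasEigenvector ⟨mem_eigenspace_iff.2 h, hw.2⟩)
  simpa using this

/-- If a symmetric nonnegative matrix is enlarged to a symmetric matrix with positive off-diagonal
entries, strictly so at some off-diagonal position, then its largest eigenvalue increases. -/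
theorem Matrix.IsHermitian.sSup_hasEigenvalue_lt {B : Matrix n n ℝ} (hA : A.IsHermitian)
    (hB : B.IsHermitian) (hA0 : ∀ i j, 0 ≤ A i j) (hAB : ∀ i j, A i j ≤ B i j)
    (hBpos : ∀ i j, i ≠ j → 0 < B i j) {u v : n} (huv : A u v < B u v) :
    sSup {μ : ℝ | HasEigenvalue (toLin' A) μ} < sSup {μ : ℝ | HasEigenvalue (toLin' B) μ} := by
  have : Nonempty n := ⟨u⟩
  by_contra! hle
  set r := sSup {μ : ℝ | HasEigenvalue (toLin' A) μ}
  have hpsd : (r • (1 : Matrix n n ℝ) - B).PosSemidef := hB.posSemidef_smul_one_sub fun μ hμ =>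
    (le_csSup B.finite_setOf_hasEigenvalue.bddAbove hμ).trans hle
  obtain ⟨x, hx⟩ := hA.hasEigenvalue_sSup.exists_hasEigenvector
  have hAx : A *ᵥ x = r • x := by simpa using hx.apply_eq_smul
  set y : n → ℝ := fun i => |x i| with hy
  have hy0 : ∀ i, 0 ≤ y i := fun i => abs_nonneg _
  have hyy : y ⬝ᵥ y = x ⬝ᵥ x := by simp [dotProduct, hy]
  have hAy : r * (y ⬝ᵥ y) ≤ y ⬝ᵥ A *ᵥ y := by
    rw [hyy, ← smul_eq_mul, ← dotProduct_smul, ← hAx]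
    simp only [dotProduct, mulVec, Finset.mul_sum]
    refine Finset.sum_le_sum fun i _ => Finset.sum_le_sum fun j _ => ?_
    refine (le_abs_self _).trans_eq ?_
    simp [abs_mul, abs_of_nonneg (hA0 i j), hy]
  have hterm : ∀ i j, 0 ≤ y i * ((B - A) i j * y j) := fun i j =>
    mul_nonneg (hy0 i) (mul_nonneg (sub_nonneg.2 (hAB i j)) (hy0 j))
  have hdiff : y u * ((B - A) u v * y v) ≤ y ⬝ᵥ (B - A) *ᵥ y := by
    simp only [dotProduct, mulVec, Finset.mul_sum]
    exact (Finset.single_le_sum (f := fun j => y u * ((B - A) u j * y j))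
      (fun j _ => hterm u j) (Finset.mem_univ v)).trans
      (Finset.single_le_sum (f := fun i => ∑ j, y i * ((B - A) i j * y j))
        (fun i _ => Finset.sum_nonneg fun j _ => hterm i j) (Finset.mem_univ u))
  rw [sub_mulVec, dotProduct_sub] at hdiff
  have hquad := hpsd.dotProduct_mulVec_nonneg y
  have hexp : star y ⬝ᵥ (r • (1 : Matrix n n ℝ) - B) *ᵥ y = r * (y ⬝ᵥ y) - y ⬝ᵥ B *ᵥ y := by
    simp [sub_mulVec, smul_mulVec, dotProduct_sub]
  have hBy : B *ᵥ y = r • y := by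
    have := (hpsd.dotProduct_mulVec_zero_iff y).1 (by linarith [hterm u v])
    rw [sub_mulVec, smul_mulVec, one_mulVec] at this
    exact (sub_eq_zero.1 this).symm
  have hzero : y u = 0 ∨ y v = 0 := by
    have h0 : y u * ((B - A) u v * y v) = 0 := le_antisymm (by linarith) (hterm u v)
    simpa [sub_ne_zero.2 huv.ne'] using h0
  obtain ⟨k, hk⟩ : ∃ k, y k = 0 := hzero.elim (fun h => ⟨u, h⟩) fun h => ⟨v, h⟩
  refine hx.2 (funext fun j => ?_)
  by_cases hkj : k = j
  · exact abs_eq_zero.1 (hkj ▸ hk)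
  · have hrow : ∑ j, B k j * y j = 0 := by simpa [mulVec, dotProduct, hk] using congrFun hBy k
    rw [Finset.sum_eq_zero_iff_of_nonneg fun j _ =>
      mul_nonneg ((hA0 k j).trans (hAB k j)) (hy0 j)] at hrow
    exact abs_eq_zero.1 <| (mul_eq_zero.1 (hrow j (Finset.mem_univ j))).resolve_left
      (hBpos k j hkj).ne'

end Spectrum

section Harary

variable {V : Type*} [Finite V]

theorem hararyMatrix_isHermitian (G : SimpleGraph V) : (hararyMatrix G).IsHermitian :=
  Matrix.IsHermitian.ext fun i j => by simp [hararyMatrix, eq_comm, G.dist_comm]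

theorem hararyMatrix_nonneg (G : SimpleGraph V) (i j : V) : 0 ≤ hararyMatrix G i j := by
  simp only [hararyMatrix, of_apply]
  positivity

theorem SimpleGraph.Connected.hararyMatrix_pos {G : SimpleGraph V} (hG : G.Connected) {i j : V}
    (hij : i ≠ j) : 0 < hararyMatrix G i j := by
  simpa [hararyMatrix, hij] using hG.pos_dist_of_ne hij

theorem SimpleGraph.Connected.hararyMatrix_mono {G H : SimpleGraph V} (hG : G.Connected)
    (hGH : G ≤ H) (i j : V) : hararyMatrix G i j ≤ hararyMatrix H i j := by
  by_cases hij : i = j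
  · simp [hararyMatrix, hij]
  · have := (hG.mono hGH).pos_dist_of_ne hij
    have := (hG i j).dist_anti hGH
    simp only [hararyMatrix, of_apply, if_neg hij]
    gcongr

end Harary

/-- Adding an edge to a connected graph strictly increases the Harary spectral radius. -/
theorem harary_rho_lt_of_add_edge {V : Type*} [Finite V] (G : SimpleGraph V)
    (hG : G.Connected) (u v : V) (huv : u ≠ v) (hadj : ¬ G.Adj u v) :
    hararyRho G < hararyRho (G ⊔ SimpleGraph.fromEdgeSet {s(u, v)}) := by
  let H := G ⊔ SimpleGraph.fromEdgeSet {s(u, v)}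
  have hGH : G ≤ H := le_sup_left
  have hH : H.Connected := hG.mono hGH
  let _ := Fintype.ofFinite V
  refine (hararyMatrix_isHermitian G).sSup_hasEigenvalue_lt (hararyMatrix_isHermitian H)
    (hararyMatrix_nonneg G) (hG.hararyMatrix_mono hGH) (fun i j => hH.hararyMatrix_pos)
    (u := u) (v := v) ?_
  have h1 : H.dist u v = 1 := SimpleGraph.dist_eq_one_iff_adj.2 (by simp [H, huv])
  have h2 := hG.one_lt_dist_of_ne_of_not_adj huv hadj
  change hararyMatrix G u v < hararyMatrix H u v
  simp only [hararyMatrix, of_apply, if_neg huv, h1, Nat.cast_one, inv_one]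
  exact inv_lt_one_of_one_lt₀ (mod_cast h2)
end

section
/- Let n_1, n_2 ≥ 1 and n = n_1 + n_2. The Harary spectral radius of the complete bipartite graph K_{n_1,n_2} equals ρ(K_{n_1,n_2}) = (n − 2 + √(n² + 12 n_1 n_2))/4. -/
open scoped Classical

lemma dist_completeBipartiteGraph_inl_inr {α β : Type*} (a : α) (b : β) :
    (completeBipartiteGraph α β).dist (Sum.inl a) (Sum.inr b) = 1 := by
  rw [SimpleGraph.dist_eq_one_iff_adj]; simp

lemma dist_completeBipartiteGraph_inl_inl {α β : Type*} [Nonempty β] {a a' : α} (h : a ≠ a') :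
    (completeBipartiteGraph α β).dist (Sum.inl a) (Sum.inl a') = 2 := by
  obtain ⟨b⟩ := ‹Nonempty β›
  have h₁ : (completeBipartiteGraph α β).Adj (Sum.inl a) (Sum.inr b) := by simp
  have h₂ : (completeBipartiteGraph α β).Adj (Sum.inr b) (Sum.inl a') := by simp
  apply le_antisymm
  · exact SimpleGraph.dist_le (.cons h₁ (.cons h₂ .nil))
  · exact (h₁.reachable.trans h₂.reachable).one_lt_dist_of_ne_of_not_adj (by simpa using h)
      (by simp)

lemma dist_completeBipartiteGraph_inr_inr {α β : Type*} [Nonempty α] {b b' : β} (h : b ≠ b') :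
    (completeBipartiteGraph α β).dist (Sum.inr b) (Sum.inr b') = 2 := by
  obtain ⟨a⟩ := ‹Nonempty α›
  have h₁ : (completeBipartiteGraph α β).Adj (Sum.inr b) (Sum.inl a) := by simp
  have h₂ : (completeBipartiteGraph α β).Adj (Sum.inl a) (Sum.inr b') := by simp
  apply le_antisymm
  · exact SimpleGraph.dist_le (.cons h₁ (.cons h₂ .nil))
  · exact (h₁.reachable.trans h₂.reachable).one_lt_dist_of_ne_of_not_adj (by simpa using h)
      (by simp)

lemma sum_ite_eq_zero_half_mul {α : Type*} [Fintype α] (i : α) (x : α → ℝ) :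
    ∑ j, (if i = j then 0 else (2 : ℝ)⁻¹) * x j = (∑ j, x j - x i) / 2 := by
  have h : ∀ j, (if i = j then 0 else (2 : ℝ)⁻¹) * x j =
      2⁻¹ * x j - if i = j then 2⁻¹ * x j else 0 := fun j => by split_ifs <;> ring
  simp only [h, Finset.sum_sub_distrib, ← Finset.mul_sum, Finset.sum_ite_eq, Finset.mem_univ,
    if_true]
  ring

lemma hararyMatrix_completeBipartiteGraph_mulVec_inl {α β : Type*} [Fintype α] [Fintype β]
    [Nonempty β] (x : α ⊕ β → ℝ) (i : α) :
    (hararyMatrix (completeBipartiteGraph α β)).mulVec x (Sum.inl i) =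
      (∑ j, x (Sum.inl j) - x (Sum.inl i)) / 2 + ∑ j, x (Sum.inr j) := by
  rw [← sum_ite_eq_zero_half_mul i fun j => x (Sum.inl j)]
  simp only [Matrix.mulVec, dotProduct, Fintype.sum_sum_type]
  congr 1 <;> refine Finset.sum_congr rfl fun j _ => ?_
  · by_cases h : i = j
    · simp [hararyMatrix, h]
    · simp [hararyMatrix, h, dist_completeBipartiteGraph_inl_inl h]
  · simp [hararyMatrix, dist_completeBipartiteGraph_inl_inr]

lemma hararyMatrix_completeBipartiteGraph_mulVec_inr {α β : Type*} [Fintype α] [Fintype β]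
    [Nonempty α] (x : α ⊕ β → ℝ) (i : β) :
    (hararyMatrix (completeBipartiteGraph α β)).mulVec x (Sum.inr i) =
      ∑ j, x (Sum.inl j) + (∑ j, x (Sum.inr j) - x (Sum.inr i)) / 2 := by
  rw [← sum_ite_eq_zero_half_mul i fun j => x (Sum.inr j)]
  simp only [Matrix.mulVec, dotProduct, Fintype.sum_sum_type]
  congr 1 <;> refine Finset.sum_congr rfl fun j _ => ?_
  · rw [hararyMatrix, Matrix.of_apply, SimpleGraph.dist_comm, dist_completeBipartiteGraph_inl_inr]
    simp
  · by_cases h : i = j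
    · simp [hararyMatrix, h]
    · simp [hararyMatrix, h, dist_completeBipartiteGraph_inr_inr h]

lemma hararyMatrix_completeBipartiteGraph_mulVec_eq_smul_iff {α β : Type*} [Fintype α] [Fintype β]
    [Nonempty α] [Nonempty β] (x : α ⊕ β → ℝ) (μ : ℝ) :
    (hararyMatrix (completeBipartiteGraph α β)).mulVec x = μ • x ↔
      (∀ i, (2 * μ + 1) * x (Sum.inl i) = ∑ j, x (Sum.inl j) + 2 * ∑ j, x (Sum.inr j)) ∧
      ∀ i, (2 * μ + 1) * x (Sum.inr i) = 2 * ∑ j, x (Sum.inl j) + ∑ j, x (Sum.inr j) := by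
  rw [funext_iff, Sum.forall]
  simp only [hararyMatrix_completeBipartiteGraph_mulVec_inl,
    hararyMatrix_completeBipartiteGraph_mulVec_inr, Pi.smul_apply, smul_eq_mul]
  refine and_congr (forall_congr' fun i => ?_) (forall_congr' fun i => ?_) <;>
    constructor <;> intro h <;> linarith

/-- The Harary spectral radius of the complete bipartite graph `K_{n₁,n₂}`. -/
theorem harary_rho_completeBipartite (n₁ n₂ : ℕ) (h₁ : 1 ≤ n₁) (h₂ : 1 ≤ n₂) :
    hararyRho (completeBipartiteGraph (Fin n₁) (Fin n₂)) =
      (((n₁ + n₂ : ℕ) : ℝ) - 2 + Real.sqrt (((n₁ + n₂ : ℕ) : ℝ) ^ 2 + 12 * n₁ * n₂)) / 4 := by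
  have : Nonempty (Fin n₁) := ⟨⟨0, h₁⟩⟩
  have : Nonempty (Fin n₂) := ⟨⟨0, h₂⟩⟩
  have ha : (1 : ℝ) ≤ n₁ := by exact_mod_cast h₁
  have hb : (1 : ℝ) ≤ n₂ := by exact_mod_cast h₂
  push_cast
  set a := (n₁ : ℝ)
  set b := (n₂ : ℝ)
  set s := Real.sqrt ((a + b) ^ 2 + 12 * a * b) with hs
  have hab : 0 < a * b := by positivity
  have hs2 : s ^ 2 = (a + b) ^ 2 + 12 * a * b := Real.sq_sqrt (by positivity)
  have hsab : |a - b| < s := by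
    apply abs_lt_of_sq_lt_sq _ (Real.sqrt_nonneg _)
    nlinarith
  obtain ⟨hs₁, hs₂⟩ := abs_lt.mp hsab
  unfold hararyRho
  rw [Subsingleton.elim (Fintype.ofFinite (Fin n₁ ⊕ Fin n₂)) inferInstance]
  apply IsGreatest.csSup_eq
  constructor
  · refine Module.End.hasEigenvalue_of_hasEigenvector
      (x := Sum.elim (fun _ => 2 * b) fun _ => (b - a + s) / 2)
      ⟨Module.End.mem_eigenspace_iff.mpr ?_, fun h => ?_⟩
    · rw [@Matrix.toLin'_apply, hararyMatrix_completeBipartiteGraph_mulVec_eq_smul_iff]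
      simp only [Sum.elim_inl, Sum.elim_inr, Finset.sum_const, Finset.card_univ, Fintype.card_fin,
        nsmul_eq_mul]
      constructor <;> intro _ <;> linarith
    · have := congrFun h (Sum.inl ⟨0, h₁⟩)
      simp only [Sum.elim_inl, Pi.zero_apply] at this
      linarith
  · rintro μ hμ
    obtain ⟨x, hx, hx0⟩ := Module.End.HasEigenvalue.exists_hasEigenvector hμ
    rw [Module.End.mem_eigenspace_iff, @Matrix.toLin'_apply,
      hararyMatrix_completeBipartiteGraph_mulVec_eq_smul_iff] at hx
    obtain ⟨hl, hr⟩ := hx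
    set S := ∑ j, x (Sum.inl j)
    set T := ∑ j, x (Sum.inr j)
    by_contra! hlt
    have hS : (2 * μ + 1) * S = a * (S + 2 * T) := by
      change (2 * μ + 1) * ∑ j, x (Sum.inl j) = _
      rw [Finset.mul_sum, Finset.sum_congr rfl fun i _ => hl i, Finset.sum_const,
        Finset.card_univ, Fintype.card_fin, nsmul_eq_mul]
    have hT : (2 * μ + 1) * T = b * (2 * S + T) := by
      change (2 * μ + 1) * ∑ j, x (Sum.inr j) = _
      rw [Finset.mul_sum, Finset.sum_congr rfl fun i _ => hr i, Finset.sum_const,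
        Finset.card_univ, Fintype.card_fin, nsmul_eq_mul]
    have hpos : 0 < (2 * μ + 1 - a) * (2 * μ + 1 - b) - 4 * a * b := by
      have : (b - a + s) / 2 * ((a - b + s) / 2) < (2 * μ + 1 - a) * (2 * μ + 1 - b) :=
        mul_lt_mul'' (by linarith) (by linarith) (by linarith) (by linarith)
      linarith
    have hS0 : S = 0 := (mul_eq_zero.mp (by linear_combination (2 * μ + 1 - b) * hS + 2 * a * hT :
      ((2 * μ + 1 - a) * (2 * μ + 1 - b) - 4 * a * b) * S = 0)).resolve_left hpos.ne'
    have hT0 : T = 0 := (mul_eq_zero.mp (by linear_combination (2 * μ + 1 - a) * hT + 2 * b * hS :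
      ((2 * μ + 1 - a) * (2 * μ + 1 - b) - 4 * a * b) * T = 0)).resolve_left hpos.ne'
    have hμ0 : 2 * μ + 1 ≠ 0 := by linarith
    refine hx0 (funext (Sum.forall.mpr ⟨fun i => ?_, fun i => ?_⟩))
    · exact (mul_eq_zero.mp ((hl i).trans (by rw [hS0, hT0]; ring))).resolve_left hμ0
    · exact (mul_eq_zero.mp ((hr i).trans (by rw [hS0, hT0]; ring))).resolve_left hμ0
end
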